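/- Let p ∈ ℝ[x₁,…,xₙ] be a square-free real-zero polynomial of degree d, let q be a nonzero homogeneous polynomial and 𝓠 a k×d polynomial matrix with q² · 𝓗(p) = 𝓠ᵀ𝓠. Working over the field ℝ(x₁,…,xₙ) of rational functions, 𝓗(p) is invertible; define the k×k matrix 𝓜 := q^{−2} · 𝓠 · L_t · 𝓗(p)^{−1} · 𝓠ᵀ over ℝ(x₁,…,xₙ). Then: (i) 𝓜 is symmetric, 𝓜ᵀ = 𝓜; (ii) det(I − 𝓜) = p in ℝ(x₁,…,xₙ); (iii) every entry of 𝓜 can be written as f/g with f, g ∈ ℝ[x₁,…,xₙ] homogeneous, g ≠ 0 and deg f = deg g + 1. -/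

import Mathlib

open Matrix

/-- Write `p = Σ_{i=0}^d p_i` with `p_i` homogeneous of degree `i`, and let
`P(x,t) = Σ_{i=0}^d p_i t^{d-i}` be the homogenization of `p` with respect to `t`.
This is the companion matrix `L_t` of `P` (as a monic polynomial in `t` of degree `d`):
subdiagonal entries `1`, last column `(-p_d, -p_{d-1}, …, -p_1)ᵀ`. -/
noncomputable def companionM {n : ℕ} (d : ℕ) (p : MvPolynomial (Fin n) ℝ) :
    Matrix (Fin d) (Fin d) (MvPolynomial (Fin n) ℝ) := fun i j =>
  if (j : ℕ) = d - 1 then -(MvPolynomial.homogeneousComponent (d - (i : ℕ)) p)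
  else if (i : ℕ) = (j : ℕ) + 1 then 1 else 0

/-- The parametrized Hermite matrix `𝓗(p)` of `p` (for `p` of degree `d`): the `d × d`
matrix over `ℝ[x₁,…,xₙ]` whose `(i,j)`-entry (1-based) is the Newton sum
`N_{i+j-2}(P) = trace (L_t^{i+j-2})`. -/
noncomputable def hermiteM {n : ℕ} (d : ℕ) (p : MvPolynomial (Fin n) ℝ) :
    Matrix (Fin d) (Fin d) (MvPolynomial (Fin n) ℝ) := fun i j =>
  Matrix.trace (companionM d p ^ ((i : ℕ) + (j : ℕ)))

/-- A polynomial `p ∈ ℝ[x₁,…,xₙ]` with `p(0) = 1` is a real-zero polynomial if for every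
`a ∈ ℝⁿ` all complex roots of the univariate polynomial `t ↦ p(ta)` are real. -/
def IsRealZero {n : ℕ} (p : MvPolynomial (Fin n) ℝ) : Prop :=
  MvPolynomial.constantCoeff p = 1 ∧
  ∀ (a : Fin n → ℝ) (z : ℂ),
    (MvPolynomial.aeval (fun i => z * algebraMap ℝ ℂ (a i))) p = 0 → z.im = 0

/-- The symmetric linear matrix polynomial `𝓜 = x₁M₁ + ⋯ + xₙMₙ` determined by
matrices `M₁, …, Mₙ`. -/
noncomputable def pencil {n k : ℕ} (M : Fin n → Matrix (Fin k) (Fin k) ℝ) :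
    Matrix (Fin k) (Fin k) (MvPolynomial (Fin n) ℝ) := fun i j =>
  ∑ l, MvPolynomial.X l * MvPolynomial.C (M l i j)

namespace MvPolynomial

/-- Euler's scaling identity for homogeneous polynomials. -/
theorem IsHomogeneous.aeval_smul_args {σ R A : Type*} [CommSemiring R] [CommSemiring A]
    [Algebra R A] {f : MvPolynomial σ R} {m : ℕ} (hf : f.IsHomogeneous m) (c : A) (g : σ → A) :
    MvPolynomial.aeval (fun i => c * g i) f = c ^ m * MvPolynomial.aeval g f := by
  rw [aeval_def, aeval_def, eval₂_eq, eval₂_eq, Finset.mul_sum]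
  refine Finset.sum_congr rfl fun s hs => ?_
  have h : s.degree = m := by
    by_contra h
    exact (mem_support_iff.mp hs) (hf.coeff_eq_zero h)
  simp only [mul_pow, Finset.prod_mul_distrib, Finset.prod_pow_eq_pow_sum]
  rw [← h, show s.degree = ∑ i ∈ s.support, s i from rfl]
  ring

/-- The algebra endomorphism of `ℝ[x]` doubling every variable. -/
noncomputable def doubleVars (σ : Type*) : MvPolynomial σ ℝ →ₐ[ℝ] MvPolynomial σ ℝ :=
  aeval fun i => 2 * X i

theorem IsHomogeneous.doubleVars_eq {σ : Type*} {f : MvPolynomial σ ℝ} {m : ℕ}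
    (hf : f.IsHomogeneous m) : doubleVars σ f = 2 ^ m * f := by
  rw [doubleVars, hf.aeval_smul_args, aeval_X_left_apply]

theorem isHomogeneous_of_doubleVars_eq {σ : Type*} {f : MvPolynomial σ ℝ} {m : ℕ}
    (hf : doubleVars σ f = 2 ^ m * f) : f.IsHomogeneous m := by
  have h2 : ∀ j : ℕ, (2 : MvPolynomial σ ℝ) ^ j = C ((2 : ℝ) ^ j) := fun j => by
    rw [map_pow]; rfl
  have key : ∀ j, homogeneousComponent j (doubleVars σ f) = 2 ^ j * homogeneousComponent j f := by
    intro j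
    conv_lhs => rw [← sum_homogeneousComponent f, map_sum]
    simp only [(homogeneousComponent_isHomogeneous _ f).doubleVars_eq, h2, map_sum,
      homogeneousComponent_C_mul]
    by_cases hj : j ∈ Finset.range (f.totalDegree + 1)
    · rw [Finset.sum_eq_single_of_mem j hj]
      · rw [homogeneousComponent_eq_self (homogeneousComponent_isHomogeneous _ _)]
      · intro b _ hb
        rw [homogeneousComponent_of_mem (homogeneousComponent_isHomogeneous _ _),
          if_neg hb.symm, mul_zero]
    · rw [homogeneousComponent_eq_zero j f (by simpa using hj), mul_zero]
      refine Finset.sum_eq_zero fun b hb => ?_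
      rw [homogeneousComponent_of_mem (homogeneousComponent_isHomogeneous _ _), if_neg, mul_zero]
      rintro rfl
      exact hj hb
  intro s hs
  have h := congrArg (coeff s) (key s.degree)
  rw [hf, h2, h2, homogeneousComponent_C_mul, coeff_C_mul, coeff_C_mul,
    coeff_homogeneousComponent, if_pos rfl] at h
  have h' := mul_right_cancel₀ hs h
  have : m = s.degree := Nat.pow_right_injective (le_refl 2) (by exact_mod_cast h')
  rw [this, Finsupp.degree_eq_weight_one]; rfl

end MvPolynomial

/-- A real polynomial whose square is dominated by `c t ^ (2m)` is a multiple of `t ^ m`. -/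
theorem Polynomial.exists_eq_C_mul_X_pow_of_sq_le (m : ℕ) (c : ℝ) (u : Polynomial ℝ)
    (hu : ∀ t : ℝ, 0 < t → u.eval t ^ 2 ≤ c * t ^ (2 * m)) :
    ∃ a : ℝ, u = Polynomial.C a * Polynomial.X ^ m := by
  induction m generalizing u with
  | zero =>
    have hb : Filter.IsBoundedUnder (· ≤ ·) Filter.atTop fun x => |u.eval x| := by
      refine ⟨|c| + 1, ?_⟩
      rw [Filter.eventually_map]
      filter_upwards [Filter.eventually_gt_atTop 0] with t ht
      have h := hu t ht
      simp only [mul_zero, pow_zero, mul_one] at h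
      have h1 := le_abs_self c
      have h2 := abs_nonneg c
      exact abs_le_of_sq_le_sq (by nlinarith) (by positivity)
    have := (Polynomial.isBoundedUnder_abs_atTop_iff u).mp hb
    exact ⟨u.coeff 0, by simpa using Polynomial.eq_C_of_degree_le_zero this⟩
  | succ m ih =>
    have h0 : u.eval 0 = 0 := by
      have h1 : Filter.Tendsto (fun t : ℝ => u.eval t ^ 2) (nhdsWithin 0 (Set.Ioi 0))
          (nhds (u.eval 0 ^ 2)) :=
        (Continuous.tendsto (by fun_prop) 0).mono_left nhdsWithin_le_nhds
      have h2 : Filter.Tendsto (fun t : ℝ => c * t ^ (2 * (m + 1))) (nhdsWithin 0 (Set.Ioi 0))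
          (nhds (c * 0 ^ (2 * (m + 1)))) :=
        (Continuous.tendsto (f := fun t : ℝ => c * t ^ (2 * (m + 1)))
          (by fun_prop) 0).mono_left nhdsWithin_le_nhds
      have h3 := le_of_tendsto_of_tendsto h1 h2
        (Filter.eventually_of_mem self_mem_nhdsWithin fun t ht => hu t ht)
      simp only [mul_add, mul_one, pow_add] at h3
      norm_num at h3
      nlinarith
    obtain ⟨v, rfl⟩ : Polynomial.X ∣ u := by
      rw [Polynomial.X_dvd_iff, Polynomial.coeff_zero_eq_eval_zero, h0]
    obtain ⟨a, rfl⟩ := ih v fun t ht => by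
      have h := hu t ht
      rw [Polynomial.eval_mul, Polynomial.eval_X] at h
      have ht2 : 0 < t ^ 2 := by positivity
      refine le_of_mul_le_mul_left ?_ ht2
      calc t ^ 2 * v.eval t ^ 2 = (t * v.eval t) ^ 2 := by ring
        _ ≤ _ := h
        _ = _ := by ring
    exact ⟨a, by ring⟩

/-- Over the reals, if a sum of squares is homogeneous of degree `2m`, each summand is the square
of a form of degree `m`. -/
theorem MvPolynomial.isHomogeneous_of_sum_sq {σ ι : Type*} [Fintype ι]
    (g : ι → MvPolynomial σ ℝ) (m : ℕ)
    (hg : (∑ l, g l ^ 2).IsHomogeneous (2 * m)) (l : ι) : (g l).IsHomogeneous m := by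
  apply isHomogeneous_of_doubleVars_eq
  apply MvPolynomial.funext
  intro x
  let u : Polynomial ℝ := aeval (fun i => Polynomial.X * Polynomial.C (x i)) (g l)
  have hueval : ∀ (f : MvPolynomial σ ℝ) (t : ℝ), (aeval (fun i => Polynomial.X *
      Polynomial.C (x i)) f : Polynomial ℝ).eval t = eval (fun i => t * x i) f := by
    intro f t
    have : (Polynomial.aeval t).comp (aeval (fun i => (Polynomial.X *
      Polynomial.C (x i) : Polynomial ℝ))) = aeval (R := ℝ) (fun i => t * x i) := by
      ext i
      simp only [AlgHom.comp_apply, aeval_X, map_mul, Polynomial.aeval_X, Polynomial.aeval_C,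
        Algebra.algebraMap_self, RingHom.id_apply]
    have h := DFunLike.congr_fun this f
    rw [AlgHom.comp_apply, Polynomial.coe_aeval_eq_eval, aeval_eq_eval] at h
    exact h
  obtain ⟨a, ha⟩ := Polynomial.exists_eq_C_mul_X_pow_of_sq_le m (eval x (∑ l, g l ^ 2)) u
    fun t _ => by
      have h := hg.aeval_smul_args t x
      simp only [aeval_eq_eval] at h
      rw [hueval, mul_comm, ← h, map_sum]
      simp only [map_pow]
      exact Finset.single_le_sum (f := fun l => eval (fun i => t * x i) (g l) ^ 2)
        (fun _ _ => sq_nonneg _) (Finset.mem_univ l)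
  have h1 := hueval (g l) 1
  have h2 := hueval (g l) 2
  change u.eval _ = _ at h1 h2
  rw [ha] at h1 h2
  simp only [Polynomial.eval_mul, Polynomial.eval_C, Polynomial.eval_pow, Polynomial.eval_X,
    one_pow, one_mul, mul_one] at h1 h2
  have h3 : eval x (doubleVars σ (g l)) = eval (fun i => 2 * x i) (g l) := by
    have : (aeval x).comp (doubleVars σ) = aeval (R := ℝ) (fun i => 2 * x i) := by
      ext i; simp [doubleVars]
    simpa [aeval_eq_eval] using DFunLike.congr_fun this (g l)
  rw [h3, ← h2, map_mul, map_pow, ← h1, map_ofNat, mul_comm]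

/-- The homogenization `t ^ d + p₁ t ^ (d - 1) + ⋯ + p_d` of a polynomial with constant
coefficient `1`, as a polynomial in `t`. -/
noncomputable def homogenizedPoly {n : ℕ} (d : ℕ) (p : MvPolynomial (Fin n) ℝ) :
    Polynomial (MvPolynomial (Fin n) ℝ) :=
  Polynomial.X ^ d + ∑ i : Fin d,
    Polynomial.C (MvPolynomial.homogeneousComponent (d - (i : ℕ)) p) * Polynomial.X ^ (i : ℕ)

section homogenizedPoly

variable {n d : ℕ} {p : MvPolynomial (Fin n) ℝ}

theorem degree_homogenizedPoly_tail_lt (d : ℕ) (p : MvPolynomial (Fin n) ℝ) :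
    (∑ i : Fin d, Polynomial.C (MvPolynomial.homogeneousComponent (d - (i : ℕ)) p) *
      Polynomial.X ^ (i : ℕ)).degree < (d : WithBot ℕ) := by
  refine (Polynomial.degree_sum_le _ _).trans_lt ((Finset.sup_lt_iff (WithBot.bot_lt_coe d)).mpr
    fun i _ => (Polynomial.degree_C_mul_X_pow_le _ _).trans_lt ?_)
  exact WithBot.coe_lt_coe.mpr i.2

theorem homogenizedPoly_monic (d : ℕ) (p : MvPolynomial (Fin n) ℝ) :
    (homogenizedPoly d p).Monic :=
  Polynomial.monic_X_pow_add (degree_homogenizedPoly_tail_lt d p)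

theorem natDegree_homogenizedPoly (d : ℕ) (p : MvPolynomial (Fin n) ℝ) :
    (homogenizedPoly d p).natDegree = d := by
  apply Polynomial.natDegree_eq_of_degree_eq_some
  rw [homogenizedPoly, Polynomial.degree_add_eq_left_of_degree_lt, Polynomial.degree_X_pow]
  rw [Polynomial.degree_X_pow]
  exact degree_homogenizedPoly_tail_lt d p

theorem sum_homogeneousComponent_sub (hp : MvPolynomial.constantCoeff p = 1)
    (hd : p.totalDegree = d) :
    1 + ∑ i : Fin d, MvPolynomial.homogeneousComponent (d - (i : ℕ)) p = p := by
  conv_rhs => rw [← MvPolynomial.sum_homogeneousComponent p, hd, Finset.sum_range_succ',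
    ← Finset.sum_range_reflect]
  rw [MvPolynomial.homogeneousComponent_zero, ← MvPolynomial.constantCoeff_eq, hp, map_one,
    add_comm, ← Fin.sum_univ_eq_sum_range
      (fun j => MvPolynomial.homogeneousComponent (d - 1 - j + 1) p)]
  congr 1
  refine Finset.sum_congr rfl fun i _ => ?_
  congr 2
  have := i.2
  omega

theorem homogenizedPoly_eval_one (hp : MvPolynomial.constantCoeff p = 1)
    (hd : p.totalDegree = d) : (homogenizedPoly d p).eval 1 = p := by
  conv_rhs => rw [← sum_homogeneousComponent_sub hp hd]
  simp [homogenizedPoly, Polynomial.eval_finsetSum]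

theorem homogenizedPoly_eval_zero_ne_zero (hp : MvPolynomial.constantCoeff p = 1)
    (hd : p.totalDegree = d) : (homogenizedPoly d p).eval 0 ≠ 0 := by
  have hp0 : p ≠ 0 := by
    rintro rfl
    simp at hp
  rcases Nat.eq_zero_or_pos d with rfl | hpos
  · simp [homogenizedPoly]
  · have : NeZero d := ⟨hpos.ne'⟩
    have : (homogenizedPoly d p).eval 0 = MvPolynomial.homogeneousComponent d p := by
      rw [homogenizedPoly, Polynomial.eval_add, Polynomial.eval_finsetSum,
        Finset.sum_eq_single (0 : Fin d)]
      · simp [hpos.ne']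
      · intro i _ hi
        have : (i : ℕ) ≠ 0 := fun h => hi (Fin.ext (by simpa using h))
        simp [this]
      · simp
    rw [this]
    obtain ⟨s, hs, hs'⟩ := Finset.exists_mem_eq_sup p.support
      (MvPolynomial.support_nonempty.mpr hp0) (fun s => s.sum fun _ e => e)
    intro h0
    have h1 := MvPolynomial.coeff_homogeneousComponent d p s
    rw [h0, MvPolynomial.coeff_zero, if_pos] at h1
    · exact MvPolynomial.mem_support_iff.mp hs h1.symm
    · rw [← hd, MvPolynomial.totalDegree, hs']
      rfl

/-- The substitution `x ↦ s x`, `t ↦ s`. -/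
noncomputable def coneHom (n : ℕ) :
    Polynomial (MvPolynomial (Fin n) ℝ) →+* Polynomial (MvPolynomial (Fin n) ℝ) :=
  Polynomial.eval₂RingHom (MvPolynomial.aeval (R := ℝ) fun i =>
    (Polynomial.X * Polynomial.C (MvPolynomial.X i) :
      Polynomial (MvPolynomial (Fin n) ℝ))).toRingHom Polynomial.X

theorem aeval_X_mul_C_X {f : MvPolynomial (Fin n) ℝ} {m : ℕ} (hf : f.IsHomogeneous m) :
    MvPolynomial.aeval (R := ℝ) (fun i => (Polynomial.X * Polynomial.C (MvPolynomial.X i) :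
      Polynomial (MvPolynomial (Fin n) ℝ))) f = Polynomial.X ^ m * Polynomial.C f := by
  rw [hf.aeval_smul_args]
  congr 1
  have : MvPolynomial.aeval (R := ℝ) (fun i => (Polynomial.C (MvPolynomial.X i) :
      Polynomial (MvPolynomial (Fin n) ℝ))) = Polynomial.CAlgHom := by
    ext i; simp
  rw [this, Polynomial.CAlgHom_apply]

theorem coneHom_homogenizedPoly (hp : MvPolynomial.constantCoeff p = 1)
    (hd : p.totalDegree = d) :
    coneHom n (homogenizedPoly d p) = Polynomial.X ^ d * Polynomial.C p := by
  conv_rhs => rw [← sum_homogeneousComponent_sub hp hd]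
  rw [homogenizedPoly, coneHom, map_add, map_sum, map_add, map_one, mul_add, mul_one, map_sum,
    Finset.mul_sum]
  congr 1
  · simp
  · refine Finset.sum_congr rfl fun i _ => ?_
    have h := aeval_X_mul_C_X (MvPolynomial.homogeneousComponent_isHomogeneous (d - (i : ℕ)) p)
    rw [map_mul, map_pow, Polynomial.coe_eval₂RingHom, Polynomial.eval₂_C, Polynomial.eval₂_X]
    change MvPolynomial.aeval _ _ * _ = _
    rw [h, mul_right_comm, ← pow_add]
    congr 2
    have := i.2
    omega

theorem coneHom_eval (A : Polynomial (MvPolynomial (Fin n) ℝ)) (y : Fin n → ℝ) {s : ℝ}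
    (hs : s ≠ 0) :
    MvPolynomial.eval (fun i => s⁻¹ * y i)
      ((coneHom n A).eval (MvPolynomial.C s)) =
      (A.map (MvPolynomial.eval y)).eval s := by
  have h : ((MvPolynomial.eval (fun i => s⁻¹ * y i)).comp
      (Polynomial.evalRingHom (MvPolynomial.C s))).comp (coneHom n) =
      (Polynomial.evalRingHom s).comp (Polynomial.mapRingHom (MvPolynomial.eval y)) := by
    ext i
    · simp [coneHom]
    · simp only [coneHom, RingHom.comp_apply]
      simp [mul_right_comm, hs]
    · simp [coneHom]
  exact DFunLike.congr_fun h A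

/-- A monic square factor of the homogenization of a square-free polynomial is trivial. -/
theorem eq_one_of_sq_dvd_homogenizedPoly (hp : MvPolynomial.constantCoeff p = 1)
    (hsf : Squarefree p) (hd : p.totalDegree = d)
    {A : Polynomial (MvPolynomial (Fin n) ℝ)} (hA : A.Monic)
    (hdvd : A * A ∣ homogenizedPoly d p) : A = 1 := by
  have hp0 : p ≠ 0 := hsf.ne_zero
  obtain ⟨B, hB⟩ := hdvd
  have h1 := congrArg (coneHom n) hB
  rw [coneHom_homogenizedPoly hp hd, map_mul, map_mul] at h1
  have hα0 : coneHom n A ≠ 0 := by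
    intro h
    rw [h, zero_mul, zero_mul, mul_eq_zero] at h1
    rcases h1 with h1 | h1
    · exact pow_ne_zero _ Polynomial.X_ne_zero h1
    · exact hp0 (Polynomial.C_eq_zero.mp h1)
  obtain ⟨a, ha, hXa⟩ := Polynomial.exists_eq_pow_rootMultiplicity_mul_and_not_dvd _ hα0 0
  rw [map_zero, sub_zero] at ha hXa
  set m := Polynomial.rootMultiplicity 0 (coneHom n A)
  have hXa2 : ¬ Polynomial.X ∣ a * a := fun h =>
    (Polynomial.prime_X.dvd_or_dvd h).elim hXa hXa
  obtain ⟨b, hb⟩ := Polynomial.prime_X.pow_dvd_of_dvd_mul_left d hXa2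
    (b := Polynomial.X ^ (2 * m) * coneHom n B) ⟨Polynomial.C p, by rw [h1, ha]; ring⟩
  have h2 : Polynomial.C p = a * a * b := by
    apply mul_left_cancel₀ (pow_ne_zero d (Polynomial.X_ne_zero (R := MvPolynomial (Fin n) ℝ)))
    calc _ = (a * a) * (Polynomial.X ^ (2 * m) * coneHom n B) := by rw [h1, ha]; ring
      _ = _ := by rw [hb]; ring
  have ha0 : a ≠ 0 := by rintro rfl; exact hXa (dvd_zero _)
  have hb0 : b ≠ 0 := by
    rintro rfl
    rw [mul_zero, Polynomial.C_eq_zero] at h2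
    exact hp0 h2
  have hdeg := congrArg Polynomial.natDegree h2
  rw [Polynomial.natDegree_C, Polynomial.natDegree_mul (mul_ne_zero ha0 ha0) hb0,
    Polynomial.natDegree_mul ha0 ha0] at hdeg
  obtain ⟨a', rfl⟩ : ∃ a', a = Polynomial.C a' :=
    ⟨_, Polynomial.eq_C_of_natDegree_eq_zero (by omega)⟩
  have ha' : IsUnit a' := hsf a' ⟨b.eval 0, by
    have := congrArg (Polynomial.eval 0) h2
    simpa using this⟩
  obtain ⟨c, -, rfl⟩ := MvPolynomial.isUnit_iff_eq_C_of_isReduced.mp ha'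
  have key : ∀ y : Fin n → ℝ, A.map (MvPolynomial.eval y) = Polynomial.X ^ m * Polynomial.C c := by
    intro y
    refine Polynomial.eq_of_infinite_eval_eq _ _
      ((Set.Ioi_infinite (0 : ℝ)).mono fun s hs => ?_)
    rw [Set.mem_ofPred_eq, ← coneHom_eval A y (ne_of_gt hs), ha]
    simp
  have hPA := homogenizedPoly_eval_zero_ne_zero hp hd
  obtain ⟨y, hy⟩ : ∃ y, MvPolynomial.eval y ((homogenizedPoly d p).eval 0) ≠ 0 := by
    by_contra! h
    exact hPA (MvPolynomial.funext fun y => by rw [h, map_zero])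
  have hm : m = 0 := by
    by_contra hm
    apply hy
    have h3 := congrArg (Polynomial.eval 0) (key y)
    rw [Polynomial.eval_mul, Polynomial.eval_pow, Polynomial.eval_X, zero_pow hm, zero_mul,
      ← map_zero (MvPolynomial.eval y), Polynomial.eval_map_apply] at h3
    rw [hB, Polynomial.eval_mul, Polynomial.eval_mul, map_mul, map_mul, h3]
    simp
  apply hA.natDegree_eq_zero.mp
  rw [← hA.natDegree_map (MvPolynomial.eval y), key y, hm, pow_zero, one_mul,
    Polynomial.natDegree_C]

theorem separable_map_homogenizedPoly (hp : MvPolynomial.constantCoeff p = 1)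
    (hsf : Squarefree p) (hd : p.totalDegree = d) (K : Type*) [Field K]
    [Algebra (MvPolynomial (Fin n) ℝ) K] [IsFractionRing (MvPolynomial (Fin n) ℝ) K] :
    ((homogenizedPoly d p).map (algebraMap (MvPolynomial (Fin n) ℝ) K)).Separable := by
  have hinj := IsFractionRing.injective (MvPolynomial (Fin n) ℝ) K
  have : CharZero K := charZero_of_injective_algebraMap hinj
  rw [PerfectField.separable_iff_squarefree]
  intro a ha
  have hP := homogenizedPoly_monic d p
  have ha0 : a ≠ 0 := by
    rintro rfl
    rw [zero_mul, zero_dvd_iff] at ha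
    exact (hP.map _).ne_zero ha
  obtain ⟨A, hA⟩ := IsIntegrallyClosed.eq_map_mul_C_of_dvd K hP (dvd_of_mul_left_dvd ha)
  have hlc : a.leadingCoeff ≠ 0 := Polynomial.leadingCoeff_ne_zero.mpr ha0
  have hAm : A.Monic := by
    apply Polynomial.monic_of_injective hinj
    have h := congrArg Polynomial.leadingCoeff hA
    rw [Polynomial.leadingCoeff_mul, Polynomial.leadingCoeff_C] at h
    exact mul_right_cancel₀ hlc (by rw [h, one_mul])
  have hAA : A * A ∣ homogenizedPoly d p := by
    rw [← Polynomial.map_dvd_map _ hinj (hAm.mul hAm)]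
    refine dvd_trans ⟨Polynomial.C a.leadingCoeff * Polynomial.C a.leadingCoeff, ?_⟩ ha
    rw [Polynomial.map_mul]
    nth_rewrite 1 [← hA]
    nth_rewrite 2 [← hA]
    ring
  rw [← hA, eq_one_of_sq_dvd_homogenizedPoly hp hsf hd hAm hAA, Polynomial.map_one, one_mul]
  exact Polynomial.isUnit_C.mpr hlc.isUnit

end homogenizedPoly

section Vandermonde

variable {n d : ℕ} {p : MvPolynomial (Fin n) ℝ}

/-- The Vandermonde matrix of the roots of the homogenization diagonalizes the companion matrix. -/
theorem vandermonde_mul_companionM {F : Type*} [CommRing F] (ψ : MvPolynomial (Fin n) ℝ →+* F)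
    (v : Fin d → F) (hv : ∀ i, (homogenizedPoly d p).eval₂ ψ (v i) = 0) :
    Matrix.vandermonde v * (companionM d p).map ψ = Matrix.diagonal v * Matrix.vandermonde v := by
  ext i j
  rw [Matrix.diagonal_mul, Matrix.mul_apply, Matrix.vandermonde_apply, ← pow_succ']
  simp only [Matrix.vandermonde_apply, Matrix.map_apply, companionM]
  by_cases hj : (j : ℕ) = d - 1
  · have h := hv i
    rw [homogenizedPoly, Polynomial.eval₂_add, Polynomial.eval₂_X_pow,
      Polynomial.eval₂_finsetSum] at h
    simp only [Polynomial.eval₂_mul, Polynomial.eval₂_C, Polynomial.eval₂_X_pow] at h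
    have hjd : (j : ℕ) + 1 = d := by have := j.2; omega
    simp only [if_pos hj, map_neg, hjd, mul_neg, Finset.sum_neg_distrib]
    rw [neg_eq_iff_add_eq_zero, add_comm, ← h]
    simp only [mul_comm]
  · have hjd : (j : ℕ) + 1 < d := by have := j.2; omega
    simp only [if_neg hj]
    rw [Finset.sum_eq_single ⟨(j : ℕ) + 1, hjd⟩]
    · simp
    · intro b _ hb
      rw [if_neg (fun h => hb (Fin.ext h)), map_zero, mul_zero]
    · simp

theorem vandermonde_mul_companionM_pow {F : Type*} [CommRing F]
    (ψ : MvPolynomial (Fin n) ℝ →+* F)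
    (v : Fin d → F) (hv : ∀ i, (homogenizedPoly d p).eval₂ ψ (v i) = 0) (m : ℕ) :
    Matrix.vandermonde v * (companionM d p).map ψ ^ m =
      Matrix.diagonal v ^ m * Matrix.vandermonde v := by
  induction m with
  | zero => simp
  | succ m ih =>
    rw [pow_succ, ← Matrix.mul_assoc, ih, Matrix.mul_assoc, vandermonde_mul_companionM ψ v hv,
      ← Matrix.mul_assoc, ← pow_succ]

theorem hermiteM_map_eq {F : Type*} [Field F] (ψ : MvPolynomial (Fin n) ℝ →+* F)
    (v : Fin d → F) (hvi : Function.Injective v)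
    (hv : ∀ i, (homogenizedPoly d p).eval₂ ψ (v i) = 0) :
    (hermiteM d p).map ψ = (Matrix.vandermonde v)ᵀ * Matrix.vandermonde v := by
  have hV : IsUnit (Matrix.vandermonde v).det :=
    (Matrix.det_vandermonde_ne_zero_iff.mpr hvi).isUnit
  ext i j
  have h := vandermonde_mul_companionM_pow ψ v hv ((i : ℕ) + j)
  have h1 : (companionM d p).map ψ ^ ((i : ℕ) + j) =
      (Matrix.vandermonde v)⁻¹ * (Matrix.diagonal v ^ ((i : ℕ) + j) * Matrix.vandermonde v) := by
    rw [← h, Matrix.nonsing_inv_mul_cancel_left _ _ hV]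
  have h2 : ψ (hermiteM d p i j) = Matrix.trace ((companionM d p).map ψ ^ ((i : ℕ) + j)) := by
    rw [hermiteM, ← RingHom.mapMatrix_apply, ← map_pow, RingHom.mapMatrix_apply]
    exact AddMonoidHom.map_trace ψ.toAddMonoidHom _
  rw [Matrix.map_apply, h2, h1, Matrix.trace_mul_comm, Matrix.mul_assoc,
    Matrix.mul_nonsing_inv _ hV, Matrix.mul_one, Matrix.diagonal_pow, Matrix.trace_diagonal,
    Matrix.mul_apply]
  simp [Matrix.vandermonde_apply, pow_add]

theorem exists_roots_homogenizedPoly (hp : MvPolynomial.constantCoeff p = 1)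
    (hsf : Squarefree p) (hd : p.totalDegree = d) (K : Type*) [Field K]
    [Algebra (MvPolynomial (Fin n) ℝ) K] [IsFractionRing (MvPolynomial (Fin n) ℝ) K]
    (F : Type*) [Field F] [IsAlgClosed F] (ι : K →+* F) :
    ∃ v : Fin d → F, Function.Injective v ∧
      (homogenizedPoly d p).map (ι.comp (algebraMap (MvPolynomial (Fin n) ℝ) K)) =
        ∏ i, (Polynomial.X - Polynomial.C (v i)) := by
  set P := (homogenizedPoly d p).map (ι.comp (algebraMap (MvPolynomial (Fin n) ℝ) K)) with hP
  have hPm : P.Monic := (homogenizedPoly_monic d p).map _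
  have hsplit : P.Splits := IsAlgClosed.splits P
  have hsep : P.Separable := by
    rw [hP, ← Polynomial.map_map]
    exact (separable_map_homogenizedPoly hp hsf hd K).map
  have hnodup := Polynomial.nodup_roots hsep
  have hcard : P.roots.card = d := by
    rw [← hsplit.natDegree_eq_card_roots, hP, (homogenizedPoly_monic d p).natDegree_map,
      natDegree_homogenizedPoly]
  have hlen : P.roots.toList.length = d := by rw [Multiset.length_toList, hcard]
  have hnd : P.roots.toList.Nodup := by
    rwa [← Multiset.coe_nodup, Multiset.coe_toList]
  refine ⟨fun i => P.roots.toList.get (i.cast hlen.symm), fun i j hij => ?_, ?_⟩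
  · have := hnd.injective_get hij
    exact Fin.ext (by simpa using congrArg Fin.val this)
  · conv_lhs => rw [hsplit.eq_prod_roots_of_monic hPm, ← Multiset.coe_toList P.roots]
    rw [Multiset.map_coe, Multiset.prod_coe, ← Equiv.prod_comp (finCongr hlen), ← List.prod_ofFn]
    congr 1
    apply List.ext_get
    · simp
    · intro i h1 h2
      simp

/-- The companion matrix is self-adjoint with respect to the Hermite form, whose determinant does
not vanish, and its characteristic polynomial at `1` recovers `p`. -/
theorem hermiteM_companionM_facts (hp : MvPolynomial.constantCoeff p = 1)
    (hsf : Squarefree p) (hd : p.totalDegree = d) :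
    (hermiteM d p).det ≠ 0 ∧ hermiteM d p * companionM d p = (companionM d p)ᵀ * hermiteM d p ∧
      (hermiteM d p)ᵀ = hermiteM d p ∧ (1 - companionM d p).det = p := by
  let K := FractionRing (MvPolynomial (Fin n) ℝ)
  let ψ := (algebraMap K (AlgebraicClosure K)).comp (algebraMap (MvPolynomial (Fin n) ℝ) K)
  have hψ : Function.Injective ψ :=
    (algebraMap K (AlgebraicClosure K)).injective.comp (IsFractionRing.injective _ K)
  obtain ⟨v, hvi, hprod⟩ := exists_roots_homogenizedPoly hp hsf hd K (AlgebraicClosure K)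
    (algebraMap K (AlgebraicClosure K))
  change (homogenizedPoly d p).map ψ = _ at hprod
  have hv : ∀ i, (homogenizedPoly d p).eval₂ ψ (v i) = 0 := fun i => by
    rw [Polynomial.eval₂_eq_eval_map, hprod, Polynomial.eval_prod]
    exact Finset.prod_eq_zero (Finset.mem_univ i) (by simp)
  have hH := hermiteM_map_eq ψ v hvi hv
  have hVL := vandermonde_mul_companionM ψ v hv
  have hVdet := Matrix.det_vandermonde_ne_zero_iff.mpr hvi
  refine ⟨fun h => ?_, ?_, ?_, ?_⟩
  · have h1 := congrArg Matrix.det hH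
    rw [← RingHom.mapMatrix_apply, ← RingHom.map_det, h, map_zero, Matrix.det_mul,
      Matrix.det_transpose] at h1
    exact mul_ne_zero hVdet hVdet h1.symm
  · apply Matrix.map_injective hψ
    beta_reduce
    rw [Matrix.map_mul, Matrix.map_mul, Matrix.transpose_map, hH, Matrix.mul_assoc, hVL,
      ← Matrix.mul_assoc, ← Matrix.mul_assoc, ← Matrix.transpose_mul, hVL, Matrix.transpose_mul,
      Matrix.diagonal_transpose]
  · ext i j
    simp only [Matrix.transpose_apply, hermiteM, add_comm]
  · apply hψ
    rw [RingHom.map_det, RingHom.mapMatrix_apply, Matrix.map_sub _ (map_sub ψ),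
      Matrix.map_one _ (map_zero ψ) (map_one ψ)]
    apply mul_left_cancel₀ hVdet
    rw [← Matrix.det_mul, Matrix.mul_sub, hVL, Matrix.mul_one]
    nth_rewrite 1 [← Matrix.one_mul (Matrix.vandermonde v)]
    rw [← Matrix.sub_mul, Matrix.det_mul, mul_comm, ← Matrix.diagonal_one, Matrix.diagonal_sub,
      Matrix.det_diagonal]
    congr 1
    have h1 := congrArg (Polynomial.eval 1) hprod
    rw [Polynomial.eval_prod, ← map_one ψ, Polynomial.eval_map_apply,
      homogenizedPoly_eval_one hp hd] at h1
    rw [h1]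
    simp

end Vandermonde

section Grading

variable {n d : ℕ} {p : MvPolynomial (Fin n) ℝ}

open MvPolynomial

/-- The diagonal matrix with entries `1, 2, 4, …, 2 ^ (d - 1)`. -/
noncomputable def doublingDiagonal (n d : ℕ) :
    Matrix (Fin d) (Fin d) (MvPolynomial (Fin n) ℝ) :=
  Matrix.diagonal fun i => 2 ^ (i : ℕ)

theorem det_doublingDiagonal (n d : ℕ) :
    (doublingDiagonal n d).det = 2 ^ ∑ i : Fin d, (i : ℕ) := by
  rw [doublingDiagonal, Matrix.det_diagonal, Finset.prod_pow_eq_pow_sum]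

theorem doublingDiagonal_mul_companionM (d : ℕ) (p : MvPolynomial (Fin n) ℝ) :
    doublingDiagonal n d * (companionM d p).map (doubleVars (Fin n)) =
      (2 : MvPolynomial (Fin n) ℝ) • (companionM d p * doublingDiagonal n d) := by
  ext1 i j
  rw [doublingDiagonal, Matrix.diagonal_mul, Matrix.smul_apply, Matrix.mul_diagonal,
    Matrix.map_apply, smul_eq_mul, companionM]
  have hi := i.2
  split_ifs with h1 h2
  · rw [map_neg, (homogeneousComponent_isHomogeneous _ p).doubleVars_eq, mul_neg, ← mul_assoc,
      ← pow_add, h1, neg_mul, mul_neg, mul_comm _ ((2 : MvPolynomial (Fin n) ℝ) ^ _), ← mul_assoc,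
      ← pow_succ']
    congr 3
    omega
  · rw [map_one, h2]
    ring
  · simp

theorem doublingDiagonal_mul_companionM_pow (m : ℕ) :
    doublingDiagonal n d * (companionM d p).map (doubleVars (Fin n)) ^ m =
      (2 ^ m : MvPolynomial (Fin n) ℝ) • (companionM d p ^ m * doublingDiagonal n d) := by
  induction m with
  | zero => simp
  | succ m ih =>
    rw [pow_succ, ← Matrix.mul_assoc, ih, Matrix.smul_mul, Matrix.mul_assoc,
      doublingDiagonal_mul_companionM d p, Matrix.mul_smul, smul_smul, ← Matrix.mul_assoc,
      ← pow_succ, ← pow_succ]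

theorem hermiteM_isHomogeneous (i j : Fin d) :
    (hermiteM d p i j).IsHomogeneous ((i : ℕ) + j) := by
  apply isHomogeneous_of_doubleVars_eq
  have h1 : doubleVars (Fin n) (hermiteM d p i j) =
      Matrix.trace ((companionM d p).map (doubleVars (Fin n)) ^ ((i : ℕ) + j)) := by
    rw [hermiteM, ← AlgHom.mapMatrix_apply, ← map_pow, AlgHom.mapMatrix_apply]
    exact AddMonoidHom.map_trace (doubleVars (Fin n)).toRingHom.toAddMonoidHom _
  rw [h1, hermiteM, Matrix.trace, Matrix.trace, Finset.mul_sum]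
  refine Finset.sum_congr rfl fun l _ => ?_
  have h2 := congrFun (congrFun (doublingDiagonal_mul_companionM_pow (p := p) (i + j)) l) l
  rw [doublingDiagonal, Matrix.diagonal_mul, Matrix.smul_apply, Matrix.mul_diagonal,
    smul_eq_mul] at h2
  apply mul_left_cancel₀ (pow_ne_zero (l : ℕ) (two_ne_zero (α := MvPolynomial (Fin n) ℝ)))
  rw [Matrix.diag_apply, Matrix.diag_apply, h2]
  ring

theorem hermiteM_map_doubleVars (d : ℕ) (p : MvPolynomial (Fin n) ℝ) :
    (hermiteM d p).map (doubleVars (Fin n)) =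
      doublingDiagonal n d * hermiteM d p * doublingDiagonal n d := by
  ext1 i j
  rw [doublingDiagonal, Matrix.mul_diagonal, Matrix.diagonal_mul, Matrix.map_apply,
    (hermiteM_isHomogeneous i j).doubleVars_eq]
  ring

theorem isHomogeneous_of_smul_hermiteM_eq
    {q : MvPolynomial (Fin n) ℝ} {r : ℕ} (hq : q.IsHomogeneous r) {k : ℕ}
    {Q : Matrix (Fin k) (Fin d) (MvPolynomial (Fin n) ℝ)}
    (hQ : q ^ 2 • hermiteM d p = Qᵀ * Q) (l : Fin k) (j : Fin d) :
    (Q l j).IsHomogeneous (r + j) := by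
  refine isHomogeneous_of_sum_sq (fun l => Q l j) (r + j) ?_ l
  have h : ∑ l, Q l j ^ 2 = q ^ 2 * hermiteM d p j j := by
    have := congrFun (congrFun hQ j) j
    rw [Matrix.smul_apply, smul_eq_mul, Matrix.mul_apply] at this
    rw [this]
    exact Finset.sum_congr rfl fun l _ => by rw [Matrix.transpose_apply, sq]
  rw [h]
  convert (hq.pow 2).mul (hermiteM_isHomogeneous j j) using 1
  ring

theorem map_doubleVars_of_smul_hermiteM_eq
    {q : MvPolynomial (Fin n) ℝ} {r : ℕ} (hq : q.IsHomogeneous r) {k : ℕ}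
    {Q : Matrix (Fin k) (Fin d) (MvPolynomial (Fin n) ℝ)}
    (hQ : q ^ 2 • hermiteM d p = Qᵀ * Q) :
    Q.map (doubleVars (Fin n)) =
      (2 ^ r : MvPolynomial (Fin n) ℝ) • (Q * doublingDiagonal n d) := by
  ext1 l j
  rw [doublingDiagonal, Matrix.smul_apply, Matrix.mul_diagonal, Matrix.map_apply,
    (isHomogeneous_of_smul_hermiteM_eq hq hQ l j).doubleVars_eq, smul_eq_mul]
  ring

theorem det_hermiteM_isHomogeneous (d : ℕ) (p : MvPolynomial (Fin n) ℝ) :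
    (hermiteM d p).det.IsHomogeneous (2 * ∑ i : Fin d, (i : ℕ)) := by
  apply isHomogeneous_of_doubleVars_eq
  rw [AlgHom.map_det, AlgHom.mapMatrix_apply, hermiteM_map_doubleVars d p, Matrix.det_mul,
    Matrix.det_mul, det_doublingDiagonal]
  ring

theorem mul_companionM_mul_adjugate_isHomogeneous
    {q : MvPolynomial (Fin n) ℝ} {r : ℕ} (hq : q.IsHomogeneous r) {k : ℕ}
    {Q : Matrix (Fin k) (Fin d) (MvPolynomial (Fin n) ℝ)}
    (hQ : q ^ 2 • hermiteM d p = Qᵀ * Q) (i j : Fin k) :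
    ((Q * companionM d p * (hermiteM d p).adjugate * Qᵀ) i j).IsHomogeneous
      (2 * r + 2 * ∑ i : Fin d, (i : ℕ) + 1) := by
  apply isHomogeneous_of_doubleVars_eq
  set D := doublingDiagonal n d with hD
  have hDT : Dᵀ = D := Matrix.diagonal_transpose _
  have hadj : (hermiteM d p).adjugate.map (doubleVars (Fin n)) =
      D.adjugate * ((hermiteM d p).adjugate * D.adjugate) := by
    rw [← AlgHom.mapMatrix_apply, AlgHom.map_adjugate, AlgHom.mapMatrix_apply,
      hermiteM_map_doubleVars d p, Matrix.adjugate_mul_distrib, Matrix.adjugate_mul_distrib]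
  have key : (Q * companionM d p * (hermiteM d p).adjugate * Qᵀ).map (doubleVars (Fin n)) =
      (2 ^ (2 * r + 2 * ∑ i : Fin d, (i : ℕ) + 1) : MvPolynomial (Fin n) ℝ) •
        (Q * companionM d p * (hermiteM d p).adjugate * Qᵀ) := by
    rw [Matrix.map_mul, Matrix.map_mul, Matrix.map_mul, Matrix.transpose_map,
      map_doubleVars_of_smul_hermiteM_eq hq hQ, hadj, ← hD, Matrix.transpose_smul,
      Matrix.transpose_mul, hDT]
    calc _ = (2 ^ r * 2 ^ r : MvPolynomial (Fin n) ℝ) •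
          (Q * (D * (companionM d p).map (doubleVars (Fin n))) * D.adjugate *
            (hermiteM d p).adjugate * (D.adjugate * D) * Qᵀ) := by
          simp only [Matrix.smul_mul, Matrix.mul_smul, smul_smul, Matrix.mul_assoc]
      _ = (2 ^ r * 2 ^ r * 2 : MvPolynomial (Fin n) ℝ) •
          (Q * companionM d p * (D * D.adjugate) *
            (hermiteM d p).adjugate * (D.adjugate * D) * Qᵀ) := by
          rw [doublingDiagonal_mul_companionM d p]
          simp only [Matrix.smul_mul, Matrix.mul_smul, smul_smul, Matrix.mul_assoc, ← hD]
      _ = _ := by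
          rw [Matrix.mul_adjugate, Matrix.adjugate_mul, hD, det_doublingDiagonal]
          simp only [Matrix.smul_mul, Matrix.mul_smul, smul_smul, Matrix.mul_one]
          congr 1
          ring
  exact congrFun (congrFun key i) j

end Grading

/-- Let `p` be a square-free real-zero polynomial of degree `d`, `q` a nonzero homogeneous
polynomial and `𝓠` a `k × d` polynomial matrix with `q² · 𝓗(p) = 𝓠ᵀ𝓠`. Over
`ℝ(x₁,…,xₙ)`, the matrix `𝓗(p)` is invertible, and
`𝓜 := q⁻² · 𝓠 · L_t · 𝓗(p)⁻¹ · 𝓠ᵀ` satisfies: (i) `𝓜ᵀ = 𝓜`; (ii) `det(I - 𝓜) = p`;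
(iii) every entry of `𝓜` is `f/g` with `f, g` homogeneous, `g ≠ 0`, `deg f = deg g + 1`. -/
theorem rational_determinantal_representation {n : ℕ} (p : MvPolynomial (Fin n) ℝ) (d : ℕ)
    (hRZ : IsRealZero p) (hsf : Squarefree p) (hdeg : p.totalDegree = d)
    (q : MvPolynomial (Fin n) ℝ) (hq0 : q ≠ 0) (r : ℕ) (hqh : q.IsHomogeneous r)
    (k : ℕ) (Q : Matrix (Fin k) (Fin d) (MvPolynomial (Fin n) ℝ))
    (hQ : q ^ 2 • hermiteM d p = Qᵀ * Q) :
    letI K := FractionRing (MvPolynomial (Fin n) ℝ)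
    letI φ := algebraMap (MvPolynomial (Fin n) ℝ) K
    letI Mm : Matrix (Fin k) (Fin k) K :=
      (φ q ^ 2)⁻¹ • (Q.map φ * (companionM d p).map φ * ((hermiteM d p).map φ)⁻¹ * (Q.map φ)ᵀ)
    IsUnit ((hermiteM d p).map φ) ∧
    Mmᵀ = Mm ∧
    Matrix.det (1 - Mm) = φ p ∧
    ∀ i j : Fin k, ∃ (f g : MvPolynomial (Fin n) ℝ) (e : ℕ),
      f.IsHomogeneous (e + 1) ∧ g.IsHomogeneous e ∧ g ≠ 0 ∧ Mm i j = φ f / φ g := by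
  let K := FractionRing (MvPolynomial (Fin n) ℝ)
  let φ : MvPolynomial (Fin n) ℝ →+* K := algebraMap (MvPolynomial (Fin n) ℝ) K
  let Mm : Matrix (Fin k) (Fin k) K :=
    (φ q ^ 2)⁻¹ • (Q.map φ * (companionM d p).map φ * ((hermiteM d p).map φ)⁻¹ * (Q.map φ)ᵀ)
  change IsUnit ((hermiteM d p).map φ) ∧ Mmᵀ = Mm ∧ Matrix.det (1 - Mm) = φ p ∧
    ∀ i j : Fin k, ∃ (f g : MvPolynomial (Fin n) ℝ) (e : ℕ),
      f.IsHomogeneous (e + 1) ∧ g.IsHomogeneous e ∧ g ≠ 0 ∧ Mm i j = φ f / φ g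
  have hp := hRZ.1
  have hφ : Function.Injective φ := IsFractionRing.injective _ K
  obtain ⟨hdet, hHL, hHT, hcharp⟩ := hermiteM_companionM_facts hp hsf hdeg
  have hφq : φ q ^ 2 ≠ 0 := pow_ne_zero 2 ((map_ne_zero_iff φ hφ).mpr hq0)
  set H := (hermiteM d p).map φ with hH
  set L := (companionM d p).map φ with hL
  set A := Q.map φ with hA
  have hHdet : H.det = φ (hermiteM d p).det := by
    rw [RingHom.map_det, RingHom.mapMatrix_apply]
  have hHu : IsUnit H.det := by
    rw [hHdet]
    exact ((map_ne_zero_iff φ hφ).mpr hdet).isUnit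
  have hHL' : H * L = Lᵀ * H := by
    rw [hH, hL, ← Matrix.transpose_map, ← Matrix.map_mul, hHL, Matrix.map_mul]
  have hHT' : Hᵀ = H := by rw [hH, ← Matrix.transpose_map, hHT]
  have hQ' : φ q ^ 2 • H = Aᵀ * A := by
    rw [hA, ← Matrix.transpose_map, ← Matrix.map_mul, ← hQ, ← map_pow]
    ext i j
    simp [hH]
  have hLH : L * H⁻¹ = H⁻¹ * Lᵀ := by
    calc L * H⁻¹ = H⁻¹ * (H * L) * H⁻¹ := by rw [Matrix.nonsing_inv_mul_cancel_left _ _ hHu]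
      _ = H⁻¹ * Lᵀ * (H * H⁻¹) := by rw [hHL']; simp only [Matrix.mul_assoc]
      _ = _ := by rw [Matrix.mul_nonsing_inv _ hHu, Matrix.mul_one]
  refine ⟨(Matrix.isUnit_iff_isUnit_det _).mpr hHu, ?_, ?_, fun i j => ?_⟩
  · change ((φ q ^ 2)⁻¹ • (A * L * H⁻¹ * Aᵀ))ᵀ = (φ q ^ 2)⁻¹ • (A * L * H⁻¹ * Aᵀ)
    rw [Matrix.transpose_smul, Matrix.transpose_mul, Matrix.transpose_mul, Matrix.transpose_mul,
      Matrix.transpose_transpose, Matrix.transpose_nonsing_inv, hHT', Matrix.mul_assoc A L, hLH]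
    simp only [Matrix.mul_assoc]
  · have h1 : Mm = A * ((φ q ^ 2)⁻¹ • (L * H⁻¹ * Aᵀ)) := by
      rw [Matrix.mul_smul]
      simp only [Mm, ← hA, ← hL, ← hH, Matrix.mul_assoc]
    rw [h1, Matrix.det_one_sub_mul_comm, Matrix.smul_mul, Matrix.mul_assoc, ← hQ',
      Matrix.mul_smul, smul_smul, inv_mul_cancel₀ hφq, one_smul, Matrix.mul_assoc,
      Matrix.nonsing_inv_mul _ hHu, Matrix.mul_one]
    conv_rhs => rw [← hcharp, RingHom.map_det, map_sub, map_one, RingHom.mapMatrix_apply]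
  · refine ⟨(Q * companionM d p * (hermiteM d p).adjugate * Qᵀ) i j, q ^ 2 * (hermiteM d p).det,
      2 * r + 2 * ∑ i : Fin d, (i : ℕ), mul_companionM_mul_adjugate_isHomogeneous hqh hQ i j,
      ?_, mul_ne_zero (pow_ne_zero 2 hq0) hdet, ?_⟩
    · rw [mul_comm 2 r]
      exact (hqh.pow 2).mul (det_hermiteM_isHomogeneous d p)
    · have h1 : φ ((Q * companionM d p * (hermiteM d p).adjugate * Qᵀ) i j) =
          (A * L * H.adjugate * Aᵀ) i j := by
        rw [hA, hL, hH, ← Matrix.transpose_map, ← RingHom.mapMatrix_apply φ (hermiteM d p),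
          ← RingHom.map_adjugate, RingHom.mapMatrix_apply, ← Matrix.map_mul, ← Matrix.map_mul,
          ← Matrix.map_mul, Matrix.map_apply]
      rw [h1, map_mul, map_pow, ← hHdet]
      change ((φ q ^ 2)⁻¹ • (A * L * H⁻¹ * Aᵀ)) i j = _
      rw [Matrix.inv_def, Ring.inverse_eq_inv', Matrix.mul_smul, Matrix.smul_mul, smul_smul,
        Matrix.smul_apply, smul_eq_mul, div_eq_mul_inv, mul_inv, mul_comm]
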